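/- For all natural numbers r and k with 0 ≤ k ≤ r, the generalized binomial coefficients satisfy the identity C(r+1/2, r-k)·C(r+1/2, k) = (2r+1)^2/(2^{2r}·(2r-2k+1)·(2k+1)) · C(2r,r)·C(2r,2k). -/

import Mathlib

open scoped BigOperators Real

/-- Bernstein basis polynomial `B_i^n(x) = C(n,i) x^i (1-x)^(n-i)`. -/
noncomputable def bern (n i : ℕ) (x : ℝ) : ℝ := (n.choose i : ℝ) * x ^ i * (1 - x) ^ (n - i)

/-- Chebyshev polynomial of the second kind, evaluated at a real point. -/
noncomputable def chebU (n : ℕ) (x : ℝ) : ℝ := (Polynomial.Chebyshev.U ℝ n).eval x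

/-- Generalized binomial coefficient `C(a,k) = a(a-1)⋯(a-k+1)/k!` for real `a`. -/
noncomputable def gchoose (a : ℝ) (k : ℕ) : ℝ :=
  (∏ j ∈ Finset.range k, (a - j)) / (k.factorial : ℝ)

/-- The odd double factorial `(2n+1)!! = (2n+1)! / (2^n n!)`, as a real number. -/
noncomputable def oddDF (n : ℕ) : ℝ := ((2 * n + 1).factorial : ℝ) / (2 ^ n * n.factorial)

/-- The falling product of length `n` from `m + n + 1/2`, in terms of factorials. -/
theorem prod_range_half_sub_mul_factorial (m n : ℕ) :
    (∏ j ∈ Finset.range n, ((m : ℝ) + n + 1 / 2 - j)) *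
        ((2 * m + 1).factorial * 4 ^ n * (m + n).factorial) =
      (2 * (m + n) + 1).factorial * m.factorial := by
  induction n with
  | zero => simp
  | succ n ih =>
    have hprod : ∏ j ∈ Finset.range (n + 1), ((m : ℝ) + (n + 1 : ℕ) + 1 / 2 - j) =
        (∏ j ∈ Finset.range n, ((m : ℝ) + n + 1 / 2 - j)) * (m + n + 3 / 2) := by
      rw [Finset.prod_range_succ']
      congr 1
      · refine Finset.prod_congr rfl fun j _ => ?_
        push_cast
        ring
      · push_cast
        ring
    have hodd : (2 * (m + (n + 1)) + 1).factorial =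
        (2 * (m + n) + 3) * ((2 * (m + n) + 2) * (2 * (m + n) + 1).factorial) := by
      rw [← Nat.factorial_succ, ← Nat.factorial_succ]
      congr 1
    rw [hprod, hodd, ← Nat.add_assoc m n 1, Nat.factorial_succ (m + n)]
    push_cast
    linear_combination (2 * ((m : ℝ) + n) + 3) * (2 * (m + n) + 2) * ih

theorem gchoose_add_half (m n : ℕ) :
    gchoose ((m : ℝ) + n + 1 / 2) n =
      ((2 * (m + n) + 1) * (2 * (m + n)).factorial * m.factorial) /
        ((2 * m + 1) * (2 * m).factorial * 4 ^ n * (m + n).factorial * n.factorial) := by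
  have h := prod_range_half_sub_mul_factorial m n
  rw [Nat.factorial_succ, Nat.factorial_succ] at h
  push_cast at h
  unfold gchoose
  rw [div_eq_div_iff (by positivity) (by positivity)]
  linear_combination (n.factorial : ℝ) * h

/-- The identity
`C(r+1/2, r-k) C(r+1/2, k) = (2r+1)²/(2^{2r}(2r-2k+1)(2k+1)) · C(2r,r) C(2r,2k)` for `k ≤ r`. -/
theorem gchoose_half_identity (r k : ℕ) (h : k ≤ r) :
    gchoose ((r : ℝ) + 1 / 2) (r - k) * gchoose ((r : ℝ) + 1 / 2) k =
      (2 * (r : ℝ) + 1) ^ 2 /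
          (2 ^ (2 * r) * (2 * (r : ℝ) - 2 * (k : ℝ) + 1) * (2 * (k : ℝ) + 1)) *
        (((2 * r).choose r : ℝ) * ((2 * r).choose (2 * k) : ℝ)) := by
  obtain ⟨m, rfl⟩ := Nat.exists_eq_add_of_le' h
  have hm := gchoose_add_half k m
  rw [add_comm (k : ℝ) m] at hm
  have hcast : 2 * ((m : ℝ) + k) - 2 * k + 1 = 2 * m + 1 := by ring
  have hsub : 2 * (m + k) - (m + k) = m + k := by lia
  have hsub' : 2 * (m + k) - 2 * k = 2 * m := by lia
  rw [Nat.cast_choose ℝ (by lia : m + k ≤ 2 * (m + k)),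
    Nat.cast_choose ℝ (by lia : 2 * k ≤ 2 * (m + k)), hsub, hsub', Nat.add_sub_cancel]
  push_cast
  rw [hm, gchoose_add_half m k, hcast, Nat.add_comm k m, pow_mul, pow_add]
  norm_num only
  field_simp
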